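/- Let p be an odd prime and χ a primitive Dirichlet character modulo p^n with n ≥ 1. Then there exists a p-adic unit A ∈ ℤ_p^× such that for every k ∈ ℤ_p, χ(1 + kp) = e(A·log_p(1+kp)/p^n), where log_p is the p-adic logarithm on 1 + pℤ_p and e(z) = exp(2πiz); here A·log_p(1+kp)/p^n is interpreted via any integer representative of A·log_p(1+kp) modulo p^n (note log_p(1+kp) ∈ pℤ_p ⊂ ℤ_p). -/

import Mathlib

open Finset Filter
open scoped Topology

/-- In a finite cyclic group, every solution of `y ^ orderOf x = 1` is a power of `x`. -/
lemma IsCyclic.mem_zpowers_of_pow_orderOf_eq_one {G : Type*} [Group G] [Finite G] [IsCyclic G]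
    {x y : G} (h : y ^ orderOf x = 1) : y ∈ Subgroup.zpowers x := by
  classical
  have := Fintype.ofFinite G
  have hsub : (Subgroup.zpowers x : Set G).toFinset ⊆ univ.filter (fun a => a ^ orderOf x = 1) := by
    intro a ha
    obtain ⟨k, rfl⟩ := Subgroup.mem_zpowers_iff.mp (by simpa using ha)
    simp only [mem_filter, mem_univ, true_and]
    rw [← zpow_natCast, zpow_comm, zpow_natCast, pow_orderOf_eq_one, one_zpow]
  have hcard : (univ.filter (fun a : G => a ^ orderOf x = 1)).card ≤
      (Subgroup.zpowers x : Set G).toFinset.card := by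
    rw [Set.toFinset_card]
    refine (IsCyclic.card_pow_eq_one_le (orderOf_pos x)).trans (le_of_eq ?_)
    exact Fintype.card_zpowers.symm
  have hy : y ∈ univ.filter (fun a : G => a ^ orderOf x = 1) := by simpa using h
  rw [← Finset.eq_of_subset_of_card_le hsub hcard] at hy
  simpa using hy

namespace PadicInt

variable {p : ℕ} [hp : Fact p.Prime]

/-- The `p`-adic logarithm of `u` is `L`, with the logarithm described as
`lim (u ^ p ^ m - 1) / p ^ m`. -/
def HasLog (u : ℤ_[p]) (L : ℚ_[p]) : Prop :=
  Tendsto (fun m : ℕ => ((u : ℚ_[p]) ^ p ^ m - 1) / (p : ℚ_[p]) ^ m) atTop (𝓝 L)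

lemma norm_one_add_pow_prime_pow_sub_one (hp2 : p ≠ 2) {x : ℤ_[p]} (hx : (p : ℤ_[p]) ∣ x)
    (m : ℕ) : ‖(1 + x) ^ p ^ m - 1‖ = ‖(p : ℤ_[p]) ^ m‖ * ‖x‖ := by
  have h3 : 3 ≤ p := by have := hp.out.two_le; omega
  have hd : (p : ℤ_[p]) * x * p ∣ x ^ p := by
    have : (p : ℤ_[p]) * x * p ∣ x * x * x := by
      rw [mul_right_comm]
      exact mul_dvd_mul (mul_dvd_mul hx hx) dvd_rfl
    refine this.trans ?_
    rw [← pow_two, ← pow_succ]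
    exact pow_dvd_pow _ h3
  obtain ⟨y, hy⟩ := ZMod.exists_one_add_mul_pow_prime_pow_eq hp.out hx hd 1 m
  rw [mul_one] at hy
  have hu : ‖1 + (p : ℤ_[p]) * y‖ = 1 := by
    rw [← isUnit_iff]
    refine IsLocalRing.isUnit_of_mem_nonunits_one_sub_self _ ?_
    rw [mem_nonunits]
    have : ‖(p : ℤ_[p]) * y‖ < 1 := by
      rw [norm_mul]
      exact mul_lt_one_of_nonneg_of_lt_one_left (norm_nonneg _)
        (mem_nonunits.mp prime_p.not_isUnit) (norm_le_one _)
    simpa using this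
  rw [hy, add_sub_cancel_left, norm_mul, norm_mul, hu, mul_one]

lemma HasLog.norm_eq (hp2 : p ≠ 2) {x : ℤ_[p]} (hx : (p : ℤ_[p]) ∣ x) {L : ℚ_[p]}
    (h : HasLog (1 + x) L) : ‖L‖ = ‖x‖ := by
  refine tendsto_nhds_unique h.norm (tendsto_const_nhds.congr fun m => ?_)
  have := norm_one_add_pow_prime_pow_sub_one hp2 hx m
  have hp0 : ‖(p : ℚ_[p]) ^ m‖ ≠ 0 := by simp [hp.out.ne_zero]
  rw [norm_div, eq_div_iff hp0, mul_comm]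
  rw [← coe_natCast, ← coe_pow, ← norm_def, ← this, norm_def, coe_sub, coe_pow, coe_one]

lemma HasLog.unique {u : ℤ_[p]} {L L' : ℚ_[p]} (h : HasLog u L) (h' : HasLog u L') : L = L' :=
  tendsto_nhds_unique h h'

lemma tendsto_prime_pow : Tendsto (fun m : ℕ => (p : ℚ_[p]) ^ m) atTop (𝓝 0) :=
  tendsto_pow_atTop_nhds_zero_of_norm_lt_one Padic.norm_p_lt_one

lemma HasLog.mul {u v : ℤ_[p]} {L M : ℚ_[p]} (hu : HasLog u L) (hv : HasLog v M) :
    HasLog (u * v) (L + M) := by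
  have hp0 : (p : ℚ_[p]) ≠ 0 := by simp [hp.out.ne_zero]
  have h := (hu.add hv).add ((tendsto_prime_pow.mul hu).mul hv)
  rw [zero_mul, zero_mul, add_zero] at h
  refine h.congr fun m => ?_
  push_cast
  field_simp
  ring

lemma HasLog.pow {u : ℤ_[p]} {L : ℚ_[p]} (hu : HasLog u L) (t : ℕ) : HasLog (u ^ t) (t * L) := by
  induction t with
  | zero => simp [HasLog]
  | succ t ih =>
    rw [pow_succ, Nat.cast_succ, add_mul, one_mul]
    exact ih.mul hu

lemma _root_.Padic.norm_natCast_inv_le (n : ℕ) : ‖(n : ℚ_[p])⁻¹‖ ≤ n := by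
  rcases eq_or_ne n 0 with rfl | hn
  · simp
  have h0 : (n : ℚ_[p]) ≠ 0 := by exact_mod_cast hn
  rw [norm_inv, Padic.norm_eq_zpow_neg_valuation h0, zpow_neg, inv_inv, Padic.valuation_natCast,
    zpow_natCast]
  exact_mod_cast Nat.le_of_dvd (Nat.pos_of_ne_zero hn) pow_padicValNat_dvd

lemma tendsto_choose_prime_pow_sub_one (j : ℕ) :
    Tendsto (fun m : ℕ => ((p ^ m - 1).choose j : ℚ_[p])) atTop (𝓝 ((-1) ^ j)) := by
  induction j with
  | zero => simp
  | succ j ih =>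
    have h0 : ((j : ℚ_[p]) + 1) ≠ 0 := by exact_mod_cast j.succ_ne_zero
    have h := (ih.mul ((tendsto_prime_pow (p := p)).sub_const ((j : ℚ_[p]) + 1))).div_const
      ((j : ℚ_[p]) + 1)
    have hlim : (-1 : ℚ_[p]) ^ j * (0 - ((j : ℚ_[p]) + 1)) / ((j : ℚ_[p]) + 1)
        = (-1) ^ (j + 1) := by field_simp; ring
    rw [hlim] at h
    refine h.congr fun m => ?_
    rw [div_eq_iff h0]
    have hc := Nat.choose_succ_right_eq (p ^ m - 1) j
    have hpm : 1 ≤ p ^ m := Nat.one_le_pow _ _ hp.out.pos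
    rcases lt_or_ge (p ^ m - 1) j with hlt | hle
    · simp [Nat.choose_eq_zero_of_lt hlt, Nat.choose_eq_zero_of_lt (hlt.trans j.lt_succ_self)]
    · have hc' := congrArg (Nat.cast : ℕ → ℚ_[p]) hc
      push_cast [Nat.cast_sub hle, Nat.cast_sub hpm] at hc'
      rw [hc']
      ring

lemma one_add_pow_prime_pow_sub_one_div (x : ℚ_[p]) (m : ℕ) :
    ((1 + x) ^ p ^ m - 1) / (p : ℚ_[p]) ^ m =
      ∑' j : ℕ, ((p ^ m - 1).choose j : ℚ_[p]) * x ^ (j + 1) / ((j : ℚ_[p]) + 1) := by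
  have hp0 : (p : ℚ_[p]) ≠ 0 := by simp [hp.out.ne_zero]
  obtain ⟨N, hN⟩ : ∃ N, p ^ m = N + 1 :=
    Nat.exists_eq_succ_of_ne_zero (pow_ne_zero _ hp.out.ne_zero)
  have hN' : (p : ℚ_[p]) ^ m = N + 1 := by exact_mod_cast congrArg (Nat.cast : ℕ → ℚ_[p]) hN
  rw [tsum_eq_sum (s := range (N + 1))]
  · rw [add_comm 1 x, add_pow, hN, sum_range_succ']
    simp only [one_pow, mul_one, pow_zero, Nat.choose_zero_right, Nat.cast_one,
      add_sub_cancel_right, sum_div, add_tsub_cancel_right]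
    refine sum_congr rfl fun j _ => ?_
    have h0 : ((j : ℚ_[p]) + 1) ≠ 0 := by exact_mod_cast j.succ_ne_zero
    have hN0 : (N : ℚ_[p]) + 1 ≠ 0 := by exact_mod_cast N.succ_ne_zero
    have hc := congrArg (Nat.cast : ℕ → ℚ_[p]) (Nat.add_one_mul_choose_eq N j)
    push_cast at hc
    rw [hN', div_eq_div_iff hN0 h0]
    linear_combination (-x ^ (j + 1)) * hc
  · intro j hj
    rw [Nat.choose_eq_zero_of_lt (by simp at hj; omega)]
    simp

lemma norm_natCast_mul_pow_div_le {x : ℚ_[p]} (c j : ℕ) :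
    ‖(c : ℚ_[p]) * x ^ (j + 1) / ((j : ℚ_[p]) + 1)‖ ≤ ((j + 1 : ℕ) : ℝ) * ‖x‖ ^ (j + 1) := by
  have h1 : ‖(c : ℚ_[p])‖ ≤ 1 := by simpa using Padic.norm_int_le_one (p := p) c
  have h2 := Padic.norm_natCast_inv_le (p := p) (j + 1)
  rw [div_eq_mul_inv, norm_mul, norm_mul, norm_pow, mul_comm]
  push_cast at h2 ⊢
  refine mul_le_mul h2 ?_ (by positivity) (by positivity)
  exact mul_le_of_le_one_left (by positivity) h1

lemma summable_log_bound {x : ℤ_[p]} (hx : ‖x‖ < 1) :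
    Summable fun j : ℕ => ((j + 1 : ℕ) : ℝ) * ‖(x : ℚ_[p])‖ ^ (j + 1) := by
  refine (summable_nat_add_iff (f := fun j : ℕ => (j : ℝ) * ‖(x : ℚ_[p])‖ ^ j) 1).mpr ?_
  simpa using summable_pow_mul_geometric_of_norm_lt_one 1 (r := ‖x‖) (by simpa using hx)

lemma hasLog_tsum {x : ℤ_[p]} (hx : ‖x‖ < 1) :
    HasLog (1 + x) (∑' j : ℕ, (-1) ^ j * (x : ℚ_[p]) ^ (j + 1) / ((j : ℚ_[p]) + 1)) := by
  refine (tendsto_tsum_of_dominated_convergence (𝓕 := atTop) (f := fun (m : ℕ) (j : ℕ) =>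
    ((p ^ m - 1).choose j : ℚ_[p]) * x ^ (j + 1) / ((j : ℚ_[p]) + 1))
    (summable_log_bound hx) (fun j => ?_) ?_).congr ?_
  · exact ((tendsto_choose_prime_pow_sub_one j).mul_const _).div_const _
  · exact Eventually.of_forall fun m j => norm_natCast_mul_pow_div_le _ j
  · intro m
    rw [coe_add, coe_one, one_add_pow_prime_pow_sub_one_div]

lemma tendsto_log_series {x : ℤ_[p]} (hx : ‖x‖ < 1) :
    Tendsto (fun N => ∑ j ∈ range N, (-1) ^ j * (x : ℚ_[p]) ^ (j + 1) / ((j : ℚ_[p]) + 1)) atTop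
      (𝓝 (∑' j : ℕ, (-1) ^ j * (x : ℚ_[p]) ^ (j + 1) / ((j : ℚ_[p]) + 1))) := by
  refine ((summable_log_bound hx).of_norm_bounded fun j => ?_).hasSum.tendsto_sum_nat
  have := norm_natCast_mul_pow_div_le (x := (x : ℚ_[p])) 1 j
  simpa using this

lemma hasLog_of_tendsto_log_series {x : ℤ_[p]} (hx : ‖x‖ < 1) {L : ℚ_[p]}
    (h : Tendsto (fun N => ∑ j ∈ range N, (-1) ^ j * (x : ℚ_[p]) ^ (j + 1) / ((j : ℚ_[p]) + 1))
      atTop (𝓝 L)) : HasLog (1 + x) L :=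
  tendsto_nhds_unique (tendsto_log_series hx) h ▸ hasLog_tsum hx

end PadicInt

namespace ZMod

variable {p : ℕ} [hp : Fact p.Prime]

/-- The class of `1 + p` as a unit modulo `p ^ n`. -/
noncomputable def unitOneAddPrime (p n : ℕ) : (ZMod (p ^ n))ˣ :=
  ZMod.unitOfCoprime (1 + p) (Nat.Coprime.pow_right n (by simp))

lemma coe_unitOneAddPrime (p n : ℕ) :
    (unitOneAddPrime p n : ZMod (p ^ n)) = 1 + p := by
  simp [unitOneAddPrime]

lemma orderOf_unitOneAddPrime (hp2 : p ≠ 2) (m : ℕ) :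
    orderOf (unitOneAddPrime p (m + 1)) = p ^ m := by
  rw [← orderOf_units, coe_unitOneAddPrime, orderOf_one_add_prime hp.out hp2]

lemma one_add_prime_pow_mul_pow_eq_one (hp2 : p ≠ 2) {n j i : ℕ} (hj : 1 ≤ j) (hn : j + i = n)
    (c : ZMod (p ^ n)) : (1 + (p : ZMod (p ^ n)) ^ j * c) ^ p ^ i = 1 := by
  have h3 : 3 ≤ p := by have := hp.out.two_le; omega
  obtain ⟨y, hy⟩ := exists_one_add_mul_pow_prime_pow_eq (R := ZMod (p ^ n)) (u := p ^ j) (v := p)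
    hp.out (dvd_pow_self _ (by omega)) (by
      rw [← pow_succ', ← pow_succ, ← pow_mul]
      exact pow_dvd_pow _ (by nlinarith)) c i
  rw [hy, ← pow_add, add_comm i j, hn, ← Nat.cast_pow, ZMod.natCast_self, zero_mul, add_zero]

lemma exists_unitOneAddPrime_pow_eq (hp2 : p ≠ 2) {m : ℕ} {u : (ZMod (p ^ (m + 1)))ˣ}
    {c : ZMod (p ^ (m + 1))} (hu : (u : ZMod (p ^ (m + 1))) = 1 + p * c) :
    ∃ t : ℕ, unitOneAddPrime p (m + 1) ^ t = u := by
  have := isCyclic_units_of_prime_pow p hp.out hp2 (m + 1)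
  refine mem_powers_iff_mem_zpowers.mpr (IsCyclic.mem_zpowers_of_pow_orderOf_eq_one ?_)
  ext
  rw [orderOf_unitOneAddPrime hp2, Units.val_pow_eq_pow_val, hu]
  simpa using one_add_prime_pow_mul_pow_eq_one hp2 le_rfl (add_comm 1 m) c

end ZMod

namespace DirichletCharacter

variable {p : ℕ} [hp : Fact p.Prime]

/-- A primitive character modulo `p ^ (m + 2)` is nontrivial on the subgroup of order `p`
generated by `(1 + p) ^ p ^ m`. -/
lemma IsPrimitive.apply_one_add_prime_pow_ne_one (hp2 : p ≠ 2) {R : Type*} [CommMonoidWithZero R]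
    {m : ℕ} {χ : DirichletCharacter R (p ^ (m + 2))} (hχ : χ.IsPrimitive) :
    χ (1 + p) ^ p ^ m ≠ 1 := by
  intro h
  have hd : p ^ (m + 1) ∣ p ^ (m + 2) := pow_dvd_pow _ (by omega)
  have hf : χ.FactorsThrough (p ^ (m + 1)) := by
    rw [factorsThrough_iff_ker_unitsMap hd]
    intro u hu
    have hcast : ZMod.castHom hd (ZMod (p ^ (m + 1))) (u : ZMod (p ^ (m + 2))) = 1 := by
      simpa [ZMod.unitsMap] using congrArg Units.val (MonoidHom.mem_ker.mp hu)
    obtain ⟨c, hc⟩ : ∃ c : ZMod (p ^ (m + 2)), (u : ZMod (p ^ (m + 2))) = 1 + p ^ (m + 1) * c := by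
      obtain ⟨a, ha⟩ := ZMod.intCast_surjective (u : ZMod (p ^ (m + 2)))
      rw [← ha, map_intCast, ← Int.cast_one, ZMod.intCast_eq_intCast_iff_dvd_sub] at hcast
      obtain ⟨c, hc⟩ := hcast
      refine ⟨-c, ?_⟩
      rw [← ha, show a = 1 - ((p ^ (m + 1) : ℕ) : ℤ) * c by rw [← hc]; ring]
      push_cast
      ring
    have hord : orderOf (ZMod.unitOneAddPrime p (m + 2) ^ p ^ m) = p := by
      rw [orderOf_pow_of_dvd (pow_ne_zero _ hp.out.ne_zero), ZMod.orderOf_unitOneAddPrime hp2]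
      · rw [pow_succ, Nat.mul_div_cancel_left _ (pow_pos hp.out.pos _)]
      · rw [ZMod.orderOf_unitOneAddPrime hp2]
        exact pow_dvd_pow _ (by omega)
    have := ZMod.isCyclic_units_of_prime_pow p hp.out hp2 (m + 2)
    have hmem : u ∈ Subgroup.zpowers (ZMod.unitOneAddPrime p (m + 2) ^ p ^ m) := by
      refine IsCyclic.mem_zpowers_of_pow_orderOf_eq_one ?_
      ext
      rw [hord, Units.val_pow_eq_pow_val, hc]
      simpa using ZMod.one_add_prime_pow_mul_pow_eq_one hp2 (Nat.le_add_left 1 m)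
        (i := 1) rfl c
    refine (Subgroup.zpowers_le.mpr ?_) hmem
    rw [MonoidHom.mem_ker]
    ext
    simpa [ZMod.coe_unitOneAddPrime] using h
  have hle := Nat.sInf_le (show p ^ (m + 1) ∈ χ.conductorSet from hf)
  have hcond : sInf χ.conductorSet = p ^ (m + 2) := hχ
  rw [hcond] at hle
  exact absurd hle (not_le.mpr (Nat.pow_lt_pow_right hp.out.one_lt (by omega)))

/-- The value of a primitive character modulo `p ^ (m + 1)` at `1 + p` is the exponential of a
fraction `b / p ^ m` whose numerator is prime to `p`. -/
lemma IsPrimitive.exists_apply_one_add_prime_eq_exp (hp2 : p ≠ 2) {m : ℕ}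
    {χ : DirichletCharacter ℂ (p ^ (m + 1))} (hχ : χ.IsPrimitive) :
    ∃ b : ℕ, p.Coprime b ∧
      χ (1 + p) = Complex.exp (2 * Real.pi * Complex.I * (b / (p : ℂ) ^ m)) := by
  have hp0 : (p : ℂ) ≠ 0 := by exact_mod_cast hp.out.ne_zero
  have hroot : χ (1 + p) ^ p ^ m = 1 := by
    rw [← map_pow]
    have := ZMod.one_add_prime_pow_mul_pow_eq_one hp2 le_rfl (add_comm 1 m)
      (1 : ZMod (p ^ (m + 1)))
    rw [pow_one, mul_one] at this
    rw [this, map_one]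
  rcases m with _ | m
  · refine ⟨1, by simp, ?_⟩
    simpa [Complex.exp_two_pi_mul_I] using hroot
  · have : NeZero (p ^ (m + 1)) := ⟨pow_ne_zero _ hp.out.ne_zero⟩
    obtain ⟨b, -, hb⟩ := (Complex.isPrimitiveRoot_exp _ this.out).eq_pow_of_pow_eq_one hroot
    rw [← Complex.exp_nat_mul] at hb
    have hb' : χ (1 + p) = Complex.exp (2 * Real.pi * Complex.I * (b / (p : ℂ) ^ (m + 1))) := by
      rw [← hb]
      push_cast
      congr 1
      ring
    refine ⟨b, (Nat.Prime.coprime_iff_not_dvd hp.out).mpr ?_, hb'⟩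
    rintro ⟨c, rfl⟩
    refine hχ.apply_one_add_prime_pow_ne_one hp2 ?_
    rw [hb', ← Complex.exp_nat_mul, Complex.exp_eq_one_iff]
    refine ⟨c, ?_⟩
    push_cast
    field_simp
    ring

end DirichletCharacter

/-- Postnikov formula: for χ a primitive Dirichlet character modulo p^n (p an odd prime),
there is a p-adic unit A such that χ(1 + kp) = e(A·log_p(1 + kp)/p^n) for all k ∈ ℤ_p.
Here log_p(1+kp) is characterized as the limit of the partial sums of its defining series,
and the right-hand side is interpreted via any integer representative a of
A·log_p(1+kp) modulo p^n. -/
theorem postnikov_formula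
    (p n : ℕ) [Fact p.Prime] (hodd : Odd p) (hn : 1 ≤ n)
    (χ : DirichletCharacter ℂ (p ^ n)) (hχ : χ.IsPrimitive) :
    ∃ A : ℤ_[p], IsUnit A ∧
      ∀ (k : ℤ_[p]) (L : ℚ_[p]),
        Tendsto (fun N => ∑ j ∈ Finset.range N,
            (-1) ^ j * (((k * (p : ℤ_[p]) : ℤ_[p]) : ℚ_[p])) ^ (j + 1) / ((j : ℚ_[p]) + 1))
          atTop (nhds L) →
        ∀ a : ℤ, ‖(A : ℚ_[p]) * L - (a : ℚ_[p])‖ ≤ (p : ℝ) ^ (-(n : ℤ)) →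
          χ (PadicInt.toZModPow n (1 + k * (p : ℤ_[p]))) =
            Complex.exp (2 * Real.pi * Complex.I * (a : ℂ) / ((p : ℂ) ^ n)) := by
  have hp : p.Prime := Fact.out
  have hp2 : p ≠ 2 := by rintro rfl; exact absurd hodd (by decide)
  have hpC : (p : ℂ) ≠ 0 := by exact_mod_cast hp.ne_zero
  have hpQ : (p : ℚ_[p]) ≠ 0 := by exact_mod_cast hp.ne_zero
  have hlt : ∀ {x : ℤ_[p]}, (p : ℤ_[p]) ∣ x → ‖x‖ < 1 := fun h => by
    rwa [← PadicInt.mem_nonunits, ← IsLocalRing.mem_maximalIdeal,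
      PadicInt.maximalIdeal_eq_span_p, Ideal.mem_span_singleton]
  obtain ⟨m, rfl⟩ : ∃ m, n = m + 1 := ⟨n - 1, by omega⟩
  obtain ⟨b, hb, hχb⟩ := hχ.exists_apply_one_add_prime_eq_exp hp2
  obtain ⟨l, hl⟩ : ∃ l, PadicInt.HasLog (1 + (p : ℤ_[p])) l :=
    ⟨_, PadicInt.hasLog_tsum (hlt dvd_rfl)⟩
  have hlnorm : ‖l‖ = ‖(p : ℚ_[p])‖ := by
    rw [hl.norm_eq hp2 dvd_rfl, PadicInt.norm_def, PadicInt.coe_natCast]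
  have hpnorm : ‖(p : ℚ_[p])‖ ≠ 0 := norm_ne_zero_iff.mpr hpQ
  have hl0 : l ≠ 0 := norm_ne_zero_iff.mp (hlnorm ▸ hpnorm)
  have hA : ‖(b : ℚ_[p]) * p / l‖ = 1 := by
    rw [norm_div, norm_mul, hlnorm, mul_div_cancel_right₀ _ hpnorm, Padic.norm_natCast_eq_one_iff]
    exact hb
  refine ⟨⟨_, hA.le⟩, PadicInt.isUnit_iff.mpr hA, fun k L hL a ha => ?_⟩
  have hkp : (p : ℤ_[p]) ∣ k * p := Dvd.intro_left k rfl
  have hlog := PadicInt.hasLog_of_tendsto_log_series (hlt hkp) hL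
  have hunit : ∀ {x : ℤ_[p]}, (p : ℤ_[p]) ∣ x → IsUnit (1 + x) := fun h =>
    IsLocalRing.isUnit_of_mem_nonunits_one_sub_self _
      (PadicInt.mem_nonunits.mpr (by simpa using hlt h))
  obtain ⟨t, ht⟩ := ZMod.exists_unitOneAddPrime_pow_eq hp2 (m := m)
    (u := ((hunit hkp).map (PadicInt.toZModPow (m + 1))).unit)
    (c := PadicInt.toZModPow (m + 1) k) (by simp [mul_comm])
  have ht' : PadicInt.toZModPow (m + 1) (1 + k * (p : ℤ_[p])) =
      (1 + (p : ZMod (p ^ (m + 1)))) ^ t := by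
    rw [← ZMod.coe_unitOneAddPrime, ← Units.val_pow_eq_pow_val, ht, IsUnit.unit_spec]
  obtain ⟨v, hv⟩ := ((hunit dvd_rfl).pow t : IsUnit ((1 + (p : ℤ_[p])) ^ t))
  obtain ⟨w, hw⟩ : ∃ w, 1 + k * (p : ℤ_[p]) = (1 + p) ^ t * (1 + w) :=
    ⟨↑v⁻¹ * (1 + k * p) - 1, by rw [add_sub_cancel, ← hv, Units.mul_inv_cancel_left]⟩
  have hwd : (p : ℤ_[p]) ^ (m + 1) ∣ w := by
    have h : (p : ℤ_[p]) ^ (m + 1) ∣ v * w := by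
      rw [← Ideal.mem_span_singleton, ← PadicInt.ker_toZModPow, RingHom.mem_ker,
        show (v : ℤ_[p]) * w = (1 + k * p) - (1 + p) ^ t by rw [hw, hv]; ring, map_sub, ht']
      simp
    exact (Units.dvd_mul_left).mp h
  have hwp : (p : ℤ_[p]) ∣ w := (dvd_pow_self _ m.succ_ne_zero).trans hwd
  have hlogw := PadicInt.hasLog_tsum (hlt hwp)
  have hwnorm := hlogw.norm_eq hp2 hwp
  generalize (∑' j : ℕ, (-1) ^ j * (w : ℚ_[p]) ^ (j + 1) / ((j : ℚ_[p]) + 1)) = M at hlogw hwnorm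
  have hLM : L = t * l + M := hlog.unique (hw ▸ (hl.pow t).mul hlogw)
  have hM : ‖(b : ℚ_[p]) * p / l * M‖ ≤ (p : ℝ) ^ (-((m + 1 : ℕ) : ℤ)) := by
    rw [norm_mul, hA, one_mul, hwnorm, PadicInt.norm_le_pow_iff_mem_span_pow,
      Ideal.mem_span_singleton]
    exact hwd
  have hdvd : ((p : ℤ) ^ (m + 1)) ∣ a - t * b * p := by
    rw [← Padic.norm_int_le_pow_iff_dvd]
    have hrw : ((a - t * b * p : ℤ) : ℚ_[p]) =
        (b : ℚ_[p]) * p / l * M - ((b : ℚ_[p]) * p / l * L - a) := by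
      rw [hLM]
      push_cast
      field_simp
      ring
    rw [hrw, sub_eq_add_neg]
    exact (Padic.nonarchimedean _ _).trans (max_le hM (by rwa [norm_neg]))
  obtain ⟨c, hc⟩ := hdvd
  rw [ht', map_pow, hχb, ← Complex.exp_nat_mul, Complex.exp_eq_exp_iff_exists_int]
  refine ⟨-c, ?_⟩
  have hac : (a : ℂ) = t * b * p + (p : ℂ) ^ (m + 1) * c := by
    have := congrArg (Int.cast : ℤ → ℂ) hc
    push_cast at this
    linear_combination this
  rw [hac]
  push_cast
  field_simp
  ring
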